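/- There exists a Borel probability measure ν_0 on FG (for instance ν_0 = Σ_k λ_k δ_{π_k} with λ_k > 0, Σ_k λ_k = 1, where the generating functions of the π_k form a countable dense subset of the compact metric space (C_0, d)) with the following universality property: for every market weight sequence {μ(t)} ⊂ Δ_n satisfying Assumption (M) whose empirical measures ℙ_t converge weakly to an absolutely continuous Borel probability measure ℙ on S, one has sup_{π ∈ supp(ν_0)} W(π) = sup_{π ∈ FG} W(π) =: W*, and Cover's portfolio π̂(t) = ∫_{FG} π(μ(t)) dν_t(π) built from ν_0 satisfies lim_{t→∞} (1/t) log V̂(t) = lim_{t→∞} (1/t) log V*(t) = W*, where V̂(t) is the relative value of π̂ and V*(t) = sup_{π ∈ FG} V_π(t). In particular lim_{t→∞} (1/t) log (V̂(t)/V*(t)) = 0. -/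

import Mathlib

open MeasureTheory Filter Topology Finset
open scoped UniformConvergence ENNReal

noncomputable section

/-- The open unit simplex in `ℝⁿ`. -/
def oS (n : ℕ) : Set (Fin n → ℝ) := {p | (∀ i, 0 < p i) ∧ ∑ i, p i = 1}

/-- The closed unit simplex in `ℝⁿ`. -/
def cS (n : ℕ) : Set (Fin n → ℝ) := {p | (∀ i, 0 ≤ p i) ∧ ∑ i, p i = 1}

/-- Relative value of a (time-dependent) weight sequence `w` along market path `μ`. -/
def relV {n : ℕ} (μ w : ℕ → Fin n → ℝ) : ℕ → ℝ
  | 0 => 1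
  | t + 1 => relV μ w t * ∑ i, w t i * (μ (t + 1) i / μ t i)

/-- Relative value of a portfolio map. -/
def pV {n : ℕ} (μ : ℕ → ↥(oS n)) (π : ↥(oS n) → ↥(cS n)) : ℕ → ℝ :=
  relV (fun t => (μ t : Fin n → ℝ)) (fun t => (π (μ t) : Fin n → ℝ))

/-- A functionally generated portfolio map. -/
def IsFG {n : ℕ} (π : ↥(oS n) → ↥(cS n)) : Prop :=
  ∃ Φ : (Fin n → ℝ) → ℝ, (∀ p ∈ oS n, 0 < Φ p) ∧ ConcaveOn ℝ (oS n) Φ ∧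
    ∀ p q : ↥(oS n),
      Φ (q : Fin n → ℝ) / Φ (p : Fin n → ℝ) ≤
        ∑ i, (π p : Fin n → ℝ) i * ((q : Fin n → ℝ) i / (p : Fin n → ℝ) i)

/-- The compact set `S = {(p,q) ∈ Δₙ × Δₙ : 1/M ≤ qᵢ/pᵢ ≤ M ∀ i}`. -/
def Sset (n : ℕ) (M : ℝ) : Set ((Fin n → ℝ) × (Fin n → ℝ)) :=
  {pq | pq.1 ∈ oS n ∧ pq.2 ∈ oS n ∧ ∀ i, 1 / M ≤ pq.2 i / pq.1 i ∧ pq.2 i / pq.1 i ≤ M}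

/-- The function `ℓ_π(p,q) = log(π(p)·(q/p))`, viewed as a function on `S`. -/
def lS {n : ℕ} {M : ℝ} (π : ↥(oS n) → ↥(cS n)) (x : ↥(Sset n M)) : ℝ :=
  Real.log (∑ i, (π ⟨x.1.1, x.2.1⟩ : Fin n → ℝ) i * (x.1.2 i / x.1.1 i))

/-- The empirical measure `ℙ_t = (1/t) Σ_{s<t} δ_{(μ(s),μ(s+1))}` as a measure on `S`. -/
def empS {n : ℕ} {M : ℝ} (μ : ℕ → ↥(oS n))
    (hS : ∀ s : ℕ, ((μ s : Fin n → ℝ), (μ (s + 1) : Fin n → ℝ)) ∈ Sset n M) (t : ℕ) :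
    Measure ↥(Sset n M) :=
  (t : ℝ≥0∞)⁻¹ • ∑ s ∈ Finset.range t,
    Measure.dirac (⟨((μ s : Fin n → ℝ), (μ (s + 1) : Fin n → ℝ)), hS s⟩ : ↥(Sset n M))

/-- The family `FG`, as a subset of the space of portfolio maps with the topology of
uniform convergence. -/
def FGset (n : ℕ) : Set (↥(oS n) →ᵤ ↥(cS n)) := {π | IsFG (UniformFun.toFun π)}

instance {n : ℕ} : MeasurableSpace (↥(oS n) →ᵤ ↥(cS n)) := borel _

/-- The (topological) support of a measure: points all of whose open neighbourhoods have
positive measure. -/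
def msupp {T : Type*} [MeasurableSpace T] [TopologicalSpace T] (ν : Measure T) : Set T :=
  {x | ∀ U : Set T, IsOpen U → x ∈ U → 0 < ν U}

/-- One-step return of a portfolio map. -/
def Rr {n : ℕ} (π : ↥(oS n) → ↥(cS n)) (p q : ↥(oS n)) : ℝ :=
  ∑ i, (π p : Fin n → ℝ) i * ((q : Fin n → ℝ) i / (p : Fin n → ℝ) i)

/-- `Φ` is a normalized generating function of `π`. -/
def IsGen {n : ℕ} (π : ↥(oS n) → ↥(cS n)) (Φ : ↥(oS n) → ℝ) : Prop :=
  (∀ p, 0 < Φ p) ∧ (∀ p : ↥(oS n), (∀ i, p.1 i = (n : ℝ)⁻¹) → Φ p = 1) ∧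
    ∀ p q, Φ q / Φ p ≤ Rr π p q

/-- Uniform local Lipschitz property. -/
def LLip {n : ℕ} (Φ : ↥(oS n) → ℝ) : Prop :=
  ∀ c : ℝ, 0 < c → ∀ p q : ↥(oS n), (∀ i, c ≤ p.1 i) → (∀ i, c ≤ q.1 i) →
    |Φ q - Φ p| ≤ n / c * dist p q

lemma oS_le_one {n : ℕ} (p : ↥(oS n)) (i : Fin n) : p.1 i ≤ 1 := by
  rw [← p.2.2]
  exact Finset.single_le_sum (f := p.1) (fun j _ => (p.2.1 j).le) (Finset.mem_univ i)

/-- The barycenter. -/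
def cen (n : ℕ) (hn : 2 ≤ n) : ↥(oS n) :=
  ⟨fun _ => (n : ℝ)⁻¹, fun _ => by positivity, by
    have : (n : ℝ) ≠ 0 := by positivity
    simp [this]⟩

lemma sum_pi_le {n : ℕ} (w : ↥(cS n)) (f : Fin n → ℝ) (B : ℝ) (h : ∀ i, f i ≤ B) :
    ∑ i, w.1 i * f i ≤ B := by
  calc ∑ i, w.1 i * f i ≤ ∑ i, w.1 i * B :=
        Finset.sum_le_sum fun i _ => mul_le_mul_of_nonneg_left (h i) (w.2.1 i)
    _ = B := by rw [← Finset.sum_mul, w.2.2, one_mul]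

lemma le_sum_pi {n : ℕ} (w : ↥(cS n)) (f : Fin n → ℝ) (B : ℝ) (h : ∀ i, B ≤ f i) :
    B ≤ ∑ i, w.1 i * f i := by
  calc B = ∑ i, w.1 i * B := by rw [← Finset.sum_mul, w.2.2, one_mul]
    _ ≤ ∑ i, w.1 i * f i :=
        Finset.sum_le_sum fun i _ => mul_le_mul_of_nonneg_left (h i) (w.2.1 i)

lemma exists_gen {n : ℕ} (hn : 2 ≤ n) (π : ↥(oS n) → ↥(cS n)) (h : IsFG π) :
    ∃ Φ, IsGen π Φ := by
  obtain ⟨Φ, hpos, -, hΦ⟩ := h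
  have hc := hpos _ (cen n hn).2
  refine ⟨fun p => Φ p.1 / Φ (cen n hn).1, fun p => div_pos (hpos _ p.2) hc, ?_, ?_⟩
  · intro p hp
    have : p.1 = (cen n hn).1 := by
      funext i; rw [hp i]; rfl
    simp only [this]
    exact div_self hc.ne'
  · intro p q
    simp only
    rw [div_div_div_cancel_right₀ hc.ne']
    exact hΦ p q

lemma gen_le {n : ℕ} (hn : 2 ≤ n) {π : ↥(oS n) → ↥(cS n)} {Φ} (h : IsGen π Φ) (p) :
    Φ p ≤ n := by
  have h1 := h.2.2 (cen n hn) p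
  rw [h.2.1 (cen n hn) (fun i => rfl), div_one] at h1
  refine h1.trans (sum_pi_le _ _ _ fun i => ?_)
  have : (cen n hn).1 i = (n : ℝ)⁻¹ := rfl
  rw [this, div_inv_eq_mul]
  have := oS_le_one p i
  have : (0 : ℝ) ≤ n := by positivity
  nlinarith

lemma gen_ge {n : ℕ} (hn : 2 ≤ n) {π : ↥(oS n) → ↥(cS n)} {Φ} (h : IsGen π Φ) (p)
    (c : ℝ) (hc : 0 < c) (hp : ∀ i, c ≤ p.1 i) : c ≤ Φ p := by
  have h1 := h.2.2 p (cen n hn)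
  rw [h.2.1 (cen n hn) (fun i => rfl)] at h1
  have h2 : 1 / Φ p ≤ 1 / c := by
    refine h1.trans (sum_pi_le _ _ _ fun i => ?_)
    exact div_le_div₀ zero_le_one (oS_le_one _ i) hc (hp i)
  exact (one_div_le_one_div (h.1 p) hc).1 h2

lemma gen_lip1 {n : ℕ} (hn : 2 ≤ n) {π : ↥(oS n) → ↥(cS n)} {Φ} (h : IsGen π Φ)
    (c : ℝ) (hc : 0 < c) (p q) (hp : ∀ i, c ≤ p.1 i) : Φ q - Φ p ≤ n / c * dist p q := by
  have h1 := h.2.2 p q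
  have h2 : Rr π p q ≤ 1 + dist p q / c := by
    refine sum_pi_le _ _ _ fun i => ?_
    have hpi := p.2.1 i
    rw [div_le_iff₀ hpi]
    have h3 : |p.1 i - q.1 i| ≤ dist p q := dist_le_pi_dist p.1 q.1 i
    have h4 := neg_abs_le (p.1 i - q.1 i)
    have h5 : dist p q ≤ dist p q / c * p.1 i := by
      rw [div_mul_eq_mul_div, le_div_iff₀ hc]
      exact mul_le_mul_of_nonneg_left (hp i) dist_nonneg
    linarith
  have h3 := (div_le_iff₀ (h.1 p)).1 (h1.trans h2)
  have h4 := gen_le hn h p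
  have h5 : 0 ≤ dist p q / c := div_nonneg dist_nonneg hc.le
  have h6 : (n : ℝ) / c * dist p q = dist p q / c * n := by ring
  rw [h6]
  nlinarith

lemma gen_llip {n : ℕ} (hn : 2 ≤ n) {π : ↥(oS n) → ↥(cS n)} {Φ} (h : IsGen π Φ) : LLip Φ := by
  intro c hc p q hp hq
  rw [abs_le]
  have h1 := gen_lip1 hn h c hc p q hp
  have h2 := gen_lip1 hn h c hc q p hq
  rw [dist_comm] at h2
  constructor <;> linarith

lemma exists_lb {n : ℕ} (p : ↥(oS n)) : ∃ c : ℝ, 0 < c ∧ ∀ i, c < p.1 i := by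
  have h0 : 0 < ∏ i, p.1 i := Finset.prod_pos fun i _ => p.2.1 i
  refine ⟨(∏ i, p.1 i) / 2, by positivity, fun i => ?_⟩
  have : ∏ j, p.1 j ≤ p.1 i := by
    rw [← Finset.mul_prod_erase _ _ (Finset.mem_univ i)]
    refine mul_le_of_le_one_right (p.2.1 i).le ?_
    exact Finset.prod_le_one (fun j _ => (p.2.1 j).le) (fun j _ => oS_le_one p j)
  linarith

lemma prod_le_coord {n : ℕ} (p : ↥(oS n)) (i : Fin n) : ∏ j, p.1 j ≤ p.1 i := by
  rw [← Finset.mul_prod_erase _ _ (Finset.mem_univ i)]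
  refine mul_le_of_le_one_right (p.2.1 i).le ?_
  exact Finset.prod_le_one (fun j _ => (p.2.1 j).le) (fun j _ => oS_le_one p j)

lemma LLip.continuous {n : ℕ} {Φ : ↥(oS n) → ℝ} (h : LLip Φ) : Continuous Φ := by
  rw [continuous_iff_continuousAt]
  intro p
  obtain ⟨c, hc, hp⟩ := exists_lb p
  have hopen : {q : ↥(oS n) | ∀ i, c < q.1 i} ∈ 𝓝 p := by
    refine IsOpen.mem_nhds ?_ hp
    simp only [Set.ofPred_forall]
    exact isOpen_iInter_of_finite fun i =>
      isOpen_lt continuous_const ((continuous_apply i).comp continuous_subtype_val)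
  have hl : LipschitzOnWith (Real.toNNReal (n / c)) Φ {q : ↥(oS n) | ∀ i, c < q.1 i} := by
    refine LipschitzOnWith.of_dist_le_mul fun x hx y hy => ?_
    rw [Real.coe_toNNReal _ (by positivity), Real.dist_eq, dist_comm x y]
    exact h c hc y x (fun i => (hy i).le) (fun i => (hx i).le)
  exact hl.continuousOn.continuousAt hopen

lemma Rr_seg {n : ℕ} (π : ↥(oS n) → ↥(cS n)) (p q x : ↥(oS n)) (r : ℝ)
    (hx : x.1 = p.1 + r • (q.1 - p.1)) : Rr π p x = 1 + r * (Rr π p q - 1) := by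
  have h1 : ∀ i, (π p).1 i * (x.1 i / p.1 i)
      = (π p).1 i + r * ((π p).1 i * (q.1 i / p.1 i) - (π p).1 i) := by
    intro i
    have := (p.2.1 i).ne'
    rw [hx]
    simp only [Pi.add_apply, Pi.smul_apply, Pi.sub_apply, smul_eq_mul]
    field_simp
    try ring
  unfold Rr
  rw [Finset.sum_congr rfl fun i _ => h1 i, Finset.sum_add_distrib, ← Finset.mul_sum,
    Finset.sum_sub_distrib, (π p).2.2]

lemma seg_bound {M p q r : ℝ} (hM : 1 ≤ M) (hp : 0 < p) (hq : 0 < q) (hqp : q ≤ M * p)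
    (hr : |r| ≤ 1 / (2 * M)) : p / 2 ≤ p + r * (q - p) := by
  have h1 : |q - p| ≤ M * p := by
    rw [abs_le]; constructor <;> nlinarith
  have h2 : |r * (q - p)| ≤ p / 2 := by
    rw [abs_mul]
    calc |r| * |q - p| ≤ 1 / (2 * M) * (M * p) :=
          mul_le_mul hr h1 (abs_nonneg _) (by positivity)
      _ = p / 2 := by field_simp
  have := neg_abs_le (r * (q - p))
  linarith

lemma seg_mem {n : ℕ} {M : ℝ} (hM : 1 ≤ M) (p q : Fin n → ℝ) (h : (p, q) ∈ Sset n M) (r : ℝ)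
    (hr : |r| ≤ 1 / (2 * M)) :
    (∀ i, p i / 2 ≤ (p + r • (q - p)) i) ∧ p + r • (q - p) ∈ oS n := by
  have h1 : ∀ i, p i / 2 ≤ (p + r • (q - p)) i := by
    intro i
    simp only [Pi.add_apply, Pi.smul_apply, Pi.sub_apply, smul_eq_mul]
    exact seg_bound hM (h.1.1 i) (h.2.1.1 i) ((div_le_iff₀ (h.1.1 i)).1 (h.2.2 i).2) hr
  refine ⟨h1, fun i => lt_of_lt_of_le (by have := h.1.1 i; simp only at this; linarith) (h1 i), ?_⟩
  have h2 := h.1.2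
  have h3 := h.2.1.2
  simp only at h2 h3
  simp only [Pi.add_apply, Pi.smul_apply, Pi.sub_apply, smul_eq_mul, Finset.sum_add_distrib,
    ← Finset.mul_sum, Finset.sum_sub_distrib, h2, h3]
  ring

lemma one_le_M {n : ℕ} {M : ℝ} (p q : Fin n → ℝ) (h : (p, q) ∈ Sset n M) : 1 ≤ M := by
  have h1 : ∑ i, q i ≤ ∑ i, M * p i := Finset.sum_le_sum fun i _ =>
    (div_le_iff₀ (h.1.1 i)).1 (h.2.2 i).2
  rw [← Finset.mul_sum] at h1
  have h2 := h.1.2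
  have h3 := h.2.1.2
  simp only at h2 h3
  rw [h2, h3] at h1
  linarith

lemma Rr_bounds {n : ℕ} {M : ℝ} (π : ↥(oS n) → ↥(cS n)) (p q : ↥(oS n))
    (h : (p.1, q.1) ∈ Sset n M) : 1 / M ≤ Rr π p q ∧ Rr π p q ≤ M :=
  ⟨le_sum_pi _ _ _ fun i => (h.2.2 i).1, sum_pi_le _ _ _ fun i => (h.2.2 i).2⟩

lemma ratio_err {a b a' b' c N τ : ℝ} (hc : 0 < c) (ha : c ≤ a) (ha' : c ≤ a') (hb : 0 ≤ b)
    (hbN : b ≤ N) (h1 : |b' - b| ≤ τ) (h2 : |a' - a| ≤ τ) :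
    b / a - b' / a' ≤ τ / c + N * τ / c ^ 2 := by
  have hτ : 0 ≤ τ := (abs_nonneg _).trans h1
  have ha0 : 0 < a := hc.trans_le ha
  have ha0' : 0 < a' := hc.trans_le ha'
  have e : b / a - b' / a' = (b - b') / a' + b * (a' - a) / (a * a') := by
    field_simp
    ring
  rw [e]
  refine add_le_add ?_ ?_
  · have := abs_le.1 h1
    exact div_le_div₀ hτ (by linarith) hc ha'
  · have := abs_le.1 h2
    refine div_le_div₀ (mul_nonneg (hb.trans hbN) hτ) ?_ (by positivity) ?_
    · calc b * (a' - a) ≤ b * τ := mul_le_mul_of_nonneg_left (by linarith) hb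
        _ ≤ N * τ := mul_le_mul_of_nonneg_right hbN hτ
    · rw [sq]; exact mul_le_mul ha ha' hc.le ha0.le

/-- Comparison of one-step returns. -/
lemma cmp_step {n : ℕ} {π π' : ↥(oS n) → ↥(cS n)} {Φ₁ Φ₂ Φ : ↥(oS n) → ℝ}
    (g₁ : IsGen π Φ₁) (g₂ : IsGen π' Φ₂) (p q x y : ↥(oS n)) {h c τ : ℝ} (hh : 0 < h)
    (hx : x.1 = p.1 + (-h) • (q.1 - p.1)) (hy : y.1 = p.1 + h • (q.1 - p.1))
    (hc : 0 < c) (hp : c ≤ Φ p) (hp1 : c ≤ Φ₁ p) (hp2 : c ≤ Φ₂ p)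
    (hx0 : 0 ≤ Φ x) (hxN : Φ x ≤ n) (hy0 : 0 ≤ Φ y) (hyN : Φ y ≤ n)
    (t1 : |Φ₁ p - Φ p| ≤ τ) (t2 : |Φ₁ x - Φ x| ≤ τ) (t3 : |Φ₂ p - Φ p| ≤ τ)
    (t4 : |Φ₂ y - Φ y| ≤ τ) :
    Rr π p q - Rr π' p q ≤ |(2 * Φ p - Φ x - Φ y) / h| / Φ p
      + 2 * (τ / c + n * τ / c ^ 2) / h := by
  have r1 := g₁.2.2 p x
  rw [Rr_seg π p q x _ hx] at r1
  have r2 := g₂.2.2 p y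
  rw [Rr_seg π' p q y _ hy] at r2
  have e1 := ratio_err hc hp hp1 hx0 hxN t2 t1
  have e2 := ratio_err hc hp hp2 hy0 hyN t4 t3
  have hp0 := hc.trans_le hp
  have k : h * (Rr π p q - Rr π' p q) ≤ (2 * Φ p - Φ x - Φ y) / Φ p
      + 2 * (τ / c + n * τ / c ^ 2) := by
    have : (2 * Φ p - Φ x - Φ y) / Φ p = 2 - Φ x / Φ p - Φ y / Φ p := by
      field_simp
    rw [this]
    linarith
  have k2 : Rr π p q - Rr π' p q ≤ ((2 * Φ p - Φ x - Φ y) / h) / Φ p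
      + 2 * (τ / c + n * τ / c ^ 2) / h := by
    have : ((2 * Φ p - Φ x - Φ y) / h) / Φ p + 2 * (τ / c + n * τ / c ^ 2) / h
      = ((2 * Φ p - Φ x - Φ y) / Φ p + 2 * (τ / c + n * τ / c ^ 2)) / h := by
      field_simp
    rw [this, le_div_iff₀ hh]
    linarith
  refine k2.trans ?_
  gcongr
  exact le_abs_self _

lemma log_step {M R R' B : ℝ} (hM : 0 < M) (hR : 0 < R) (hR' : 1 / M ≤ R')
    (hB : 0 ≤ B) (h : R - R' ≤ B) : Real.log R - Real.log R' ≤ M * B := by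
  have h0 : 0 < R' := lt_of_lt_of_le (by positivity) hR'
  rw [← Real.log_div hR.ne' h0.ne']
  have h1 := Real.log_le_sub_one_of_pos (div_pos hR h0)
  have h2 : R / R' - 1 = (R - R') / R' := by field_simp
  rw [h2] at h1
  refine h1.trans ?_
  rw [div_le_iff₀ h0]
  have : 1 ≤ M * R' := by
    rw [div_le_iff₀ hM] at hR'; linarith
  nlinarith

lemma pV_succ {n : ℕ} (μ : ℕ → ↥(oS n)) (π : ↥(oS n) → ↥(cS n)) (t : ℕ) :
    pV μ π (t + 1) = pV μ π t * Rr π (μ t) (μ (t + 1)) := rfl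

lemma pV_bounds {n : ℕ} {M : ℝ} (hM : 1 ≤ M) (μ : ℕ → ↥(oS n))
    (hS : ∀ s : ℕ, ((μ s : Fin n → ℝ), (μ (s + 1) : Fin n → ℝ)) ∈ Sset n M)
    (π : ↥(oS n) → ↥(cS n)) (t : ℕ) : 0 < pV μ π t ∧ pV μ π t ≤ M ^ t := by
  induction t with
  | zero => exact ⟨by simp [pV, relV], by simp [pV, relV]⟩
  | succ t ih =>
    have hb := Rr_bounds π (μ t) (μ (t + 1)) (hS t)
    have : 0 < Rr π (μ t) (μ (t + 1)) := lt_of_lt_of_le (by positivity) hb.1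
    rw [pV_succ, pow_succ]
    exact ⟨mul_pos ih.1 this, mul_le_mul ih.2 hb.2 this.le (by positivity)⟩

lemma log_pV {n : ℕ} {M : ℝ} (hM : 1 ≤ M) (μ : ℕ → ↥(oS n))
    (hS : ∀ s : ℕ, ((μ s : Fin n → ℝ), (μ (s + 1) : Fin n → ℝ)) ∈ Sset n M)
    (π : ↥(oS n) → ↥(cS n)) (t : ℕ) :
    Real.log (pV μ π t) = ∑ s ∈ Finset.range t, Real.log (Rr π (μ s) (μ (s + 1))) := by
  induction t with
  | zero => simp [pV, relV]
  | succ t ih =>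
    have hb := Rr_bounds π (μ t) (μ (t + 1)) (hS t)
    have : 0 < Rr π (μ t) (μ (t + 1)) := lt_of_lt_of_le (by positivity) hb.1
    rw [pV_succ, Real.log_mul (pV_bounds hM μ hS π t).1.ne' this.ne', ih, Finset.sum_range_succ]

open Classical in
/-- Extension by zero. -/
def extZ {n : ℕ} (Φ : ↥(oS n) → ℝ) (y : Fin n → ℝ) : ℝ :=
  if h : y ∈ oS n then Φ ⟨y, h⟩ else 0

lemma extZ_of_mem {n : ℕ} (Φ : ↥(oS n) → ℝ) (p : ↥(oS n)) : extZ Φ p.1 = Φ p := by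
  simp [extZ, p.2]

/-- The sum functional. -/
def sumF (n : ℕ) : (Fin n → ℝ) →ₗ[ℝ] ℝ := ∑ i, LinearMap.proj i

lemma sumF_apply {n : ℕ} (x : Fin n → ℝ) : sumF n x = ∑ i, x i := by
  simp [sumF]

/-- Vectors of zero sum. -/
abbrev Vz (n : ℕ) : Submodule ℝ (Fin n → ℝ) := LinearMap.ker (sumF n)

lemma finrank_Vz {n : ℕ} (hn : 2 ≤ n) : Module.finrank ℝ (Vz n) + 1 = n := by
  have h := LinearMap.finrank_range_add_finrank_ker (sumF n)
  have hr : LinearMap.range (sumF n) = ⊤ := by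
    rw [LinearMap.range_eq_top]
    intro y
    refine ⟨Pi.single ⟨0, by omega⟩ y, ?_⟩
    rw [sumF_apply]
    simp
  rw [hr, finrank_top, Module.finrank_self, Module.finrank_fin_fun] at h
  change Module.finrank ℝ (LinearMap.ker (sumF n)) + 1 = n
  omega

lemma hasDeriv_second_diff {g : ℝ → ℝ} {g' : ℝ} (h : HasDerivAt g g' 0) :
    Tendsto (fun r : ℝ => (2 * g 0 - g (-r) - g r) / r) (𝓝[≠] 0) (𝓝 0) := by
  have h1 := h.tendsto_slope_zero
  have hneg : Tendsto (fun r : ℝ => -r) (𝓝[≠] 0) (𝓝[≠] 0) := by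
    have h3 : Tendsto (fun r : ℝ => -r) (𝓝 0) (𝓝 (-0)) := continuous_neg.tendsto 0
    rw [neg_zero] at h3
    refine tendsto_nhdsWithin_iff.2 ⟨h3.mono_left nhdsWithin_le_nhds, ?_⟩
    filter_upwards [self_mem_nhdsWithin] with r hr
    simpa using hr
  have h2 := h1.comp hneg
  have h3 := h2.sub h1
  rw [sub_self] at h3
  refine h3.congr fun r => ?_
  simp only [Function.comp_apply, zero_add, smul_eq_mul, inv_neg, div_eq_inv_mul]
  ring

lemma rad_ae {n : ℕ} (hn : 2 ≤ n) {Φ : ↥(oS n) → ℝ} (h : LLip Φ) :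
    ∀ᵐ x : (Vz n) × (Vz n) ∂(Measure.hausdorffMeasure
        (Module.finrank ℝ ((Vz n) × (Vz n)) : ℝ)),
      (cen n hn).1 + x.1.1 ∈ oS n →
      DifferentiableAt ℝ (fun y : (Vz n) × (Vz n) => extZ Φ ((cen n hn).1 + y.1.1)) x := by
  set f := fun y : (Vz n) × (Vz n) => extZ Φ ((cen n hn).1 + y.1.1) with hf
  let O : ℕ → Set ((Vz n) × (Vz n)) := fun m =>
    {x | ∀ i, 1 / ((m : ℝ) + 1) < ((cen n hn).1 + x.1.1) i}
  have hcont : ∀ i, Continuous fun x : (Vz n) × (Vz n) => ((cen n hn).1 + x.1.1) i := fun i =>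
    (continuous_apply i).comp (continuous_const.add (continuous_subtype_val.comp continuous_fst))
  have hO : ∀ m, IsOpen (O m) := by
    intro m
    simp only [O, Set.ofPred_forall]
    exact isOpen_iInter_of_finite fun i => isOpen_lt continuous_const (hcont i)
  have hmem : ∀ m, ∀ x ∈ O m, (cen n hn).1 + x.1.1 ∈ oS n := by
    intro m x hx
    refine ⟨fun i => lt_trans (by positivity) (hx i), ?_⟩
    have h1 : ∑ i, x.1.1 i = 0 := by rw [← sumF_apply]; exact x.1.2
    have h2 := (cen n hn).2.2
    simp only [Pi.add_apply, Finset.sum_add_distrib, h1, h2, add_zero]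
  have hlip : ∀ m : ℕ, LipschitzOnWith (Real.toNNReal (n / (1 / ((m : ℝ) + 1)))) f (O m) := by
    intro m
    refine LipschitzOnWith.of_dist_le_mul fun x hx y hy => ?_
    rw [Real.coe_toNNReal _ (by positivity), Real.dist_eq]
    have hc : (0 : ℝ) < 1 / ((m : ℝ) + 1) := by positivity
    have e1 : f x = Φ ⟨_, hmem m x hx⟩ := extZ_of_mem Φ ⟨_, hmem m x hx⟩
    have e2 : f y = Φ ⟨_, hmem m y hy⟩ := extZ_of_mem Φ ⟨_, hmem m y hy⟩
    rw [e1, e2]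
    refine (h _ hc ⟨_, hmem m y hy⟩ ⟨_, hmem m x hx⟩ (fun i => (hy i).le)
      (fun i => (hx i).le)).trans ?_
    refine mul_le_mul_of_nonneg_left ?_ (by positivity)
    rw [dist_comm]
    change dist ((cen n hn).1 + x.1.1) ((cen n hn).1 + y.1.1) ≤ _
    rw [dist_add_left]
    exact le_max_left (dist x.1 y.1) (dist x.2 y.2)
  have hall := ae_all_iff.2 fun m => (hlip m).ae_differentiableWithinAt_of_mem
    (μ := Measure.hausdorffMeasure (Module.finrank ℝ ((Vz n) × (Vz n)) : ℝ))
  filter_upwards [hall] with x hx hxo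
  obtain ⟨c, hc, hcx⟩ := exists_lb ⟨_, hxo⟩
  obtain ⟨m, hm⟩ := exists_nat_one_div_lt hc
  have hxm : x ∈ O m := fun i => hm.trans (hcx i)
  exact (hx m hxm).differentiableAt ((hO m).mem_nhds hxm)

lemma sub_cen_mem {n : ℕ} (hn : 2 ≤ n) (p : Fin n → ℝ) (hp : p ∈ oS n) :
    p - (cen n hn).1 ∈ Vz n := by
  rw [LinearMap.mem_ker, map_sub, sumF_apply, sumF_apply, hp.2, (cen n hn).2.2, sub_self]

lemma rad_P {n : ℕ} (hn : 2 ≤ n) {M : ℝ} {Φ : ↥(oS n) → ℝ} (h : LLip Φ)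
    (P : Measure ↥(Sset n M))
    (hP : P.map Subtype.val ≪ Measure.hausdorffMeasure (2 * (n : ℝ) - 2)) :
    ∀ᵐ x ∂P, Tendsto (fun r : ℝ => (2 * extZ Φ x.1.1
      - extZ Φ (x.1.1 + (-r) • (x.1.2 - x.1.1)) - extZ Φ (x.1.1 + r • (x.1.2 - x.1.1))) / r)
      (𝓝[≠] 0) (𝓝 0) := by
  have hrad := rad_ae hn h
  have hdim : (Module.finrank ℝ ((Vz n) × (Vz n)) : ℝ) = 2 * (n : ℝ) - 2 := by
    rw [Module.finrank_prod]
    have : ((Module.finrank ℝ (Vz n) : ℝ)) + 1 = n := by exact_mod_cast finrank_Vz hn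
    push_cast
    linarith
  rw [hdim] at hrad
  let T : (Vz n) × (Vz n) → (Fin n → ℝ) × (Fin n → ℝ) :=
    fun x => ((cen n hn).1 + x.1.1, (cen n hn).1 + x.2.1)
  have hT : Isometry T := by
    refine Isometry.of_dist_eq fun x y => ?_
    simp only [T, Prod.dist_eq, dist_add_left]
    rfl
  set B := {x : (Vz n) × (Vz n) | ¬ ((cen n hn).1 + x.1.1 ∈ oS n →
      DifferentiableAt ℝ (fun y : (Vz n) × (Vz n) => extZ Φ ((cen n hn).1 + y.1.1)) x)} with hB
  have hB0 : Measure.hausdorffMeasure (2 * (n : ℝ) - 2) B = 0 := hrad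
  have h2 : (0 : ℝ) ≤ 2 * (n : ℝ) - 2 := by
    have : (2 : ℝ) ≤ n := by exact_mod_cast hn
    linarith
  have hTB : Measure.hausdorffMeasure (2 * (n : ℝ) - 2) (T '' B) = 0 := by
    rw [hT.hausdorffMeasure_image (Or.inl h2), hB0]
  have hPB := hP hTB
  have hPB' : P (Subtype.val ⁻¹' (T '' B)) = 0 :=
    le_antisymm ((Measure.le_map_apply measurable_subtype_coe.aemeasurable _).trans hPB.le)
      zero_le
  have hae : ∀ᵐ x ∂P, x ∉ (Subtype.val ⁻¹' (T '' B) : Set ↥(Sset n M)) :=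
    measure_eq_zero_iff_ae_notMem.1 hPB'
  filter_upwards [hae] with x hx
  obtain ⟨⟨p, q⟩, hpq⟩ := x
  let u : Vz n := ⟨p - (cen n hn).1, sub_cen_mem hn p hpq.1⟩
  let v : Vz n := ⟨q - (cen n hn).1, sub_cen_mem hn q hpq.2.1⟩
  have hTuv : T (u, v) = (p, q) := by simp [T, u, v]
  have hnB : (u, v) ∉ B := fun hb => hx ⟨(u, v), hb, hTuv⟩
  have e0 : (cen n hn).1 + u.1 = p := by simp [u]
  have hd : DifferentiableAt ℝ
      (fun y : (Vz n) × (Vz n) => extZ Φ ((cen n hn).1 + y.1.1)) (u, v) := by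
    have := not_not.1 hnB
    refine this ?_
    change (cen n hn).1 + u.1 ∈ oS n
    rw [e0]; exact hpq.1
  have hl := hd.hasFDerivAt.hasLineDerivAt ((v - u, 0) : (Vz n) × (Vz n))
  have key := hasDeriv_second_diff hl
  have e : ∀ r : ℝ, extZ Φ ((cen n hn).1 + ((u, v) + r • ((v - u, 0) : (Vz n) × (Vz n))).1.1)
      = extZ Φ (p + r • (q - p)) := by
    intro r
    congr 1
    simp only [Prod.fst_add, Prod.smul_fst, Submodule.coe_add, Submodule.coe_smul,
      Submodule.coe_sub, u, v]
    funext i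
    simp only [Pi.add_apply, Pi.smul_apply, Pi.sub_apply, smul_eq_mul]
    ring
  simp only [e, zero_smul, add_zero, e0] at key
  exact key

lemma isCompact_Kc {n : ℕ} {c : ℝ} (hc : 0 < c) :
    IsCompact {p : ↥(oS n) | ∀ i, c ≤ p.1 i} := by
  rw [Subtype.isCompact_iff]
  have e : (Subtype.val '' {p : ↥(oS n) | ∀ i, c ≤ p.1 i}) =
      Set.Icc (fun _ => c) (fun _ => 1) ∩ {y : Fin n → ℝ | ∑ i, y i = 1} := by
    ext y
    constructor
    · rintro ⟨p, hp, rfl⟩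
      exact ⟨⟨fun i => hp i, fun i => oS_le_one p i⟩, p.2.2⟩
    · rintro ⟨⟨h1, h2⟩, h3⟩
      exact ⟨⟨y, fun i => hc.trans_le (h1 i), h3⟩, fun i => h1 i, rfl⟩
  rw [e]
  refine isCompact_Icc.inter_right ?_
  exact isClosed_eq (continuous_finsetSum _ fun i _ => continuous_apply i) continuous_const

lemma unif_of_ptwise {n : ℕ} {l : Filter ℕ} {F : ℕ → ↥(oS n) → ℝ} {Φ : ↥(oS n) → ℝ}
    (hF : ∀ t, LLip (F t)) (hΦ : LLip Φ) (hl : ∀ p, Tendsto (fun t => F t p) l (𝓝 (Φ p)))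
    {c τ : ℝ} (hc : 0 < c) (hτ : 0 < τ) :
    ∀ᶠ t in l, ∀ p : ↥(oS n), (∀ i, c ≤ p.1 i) → |F t p - Φ p| ≤ τ := by
  set L : ℝ := n / c with hL
  have hL0 : 0 ≤ L := by positivity
  have he : 0 < τ / (3 * (L + 1)) := by positivity
  obtain ⟨N, hNK, hNf, hcov⟩ := (isCompact_Kc (n := n) hc).finite_cover_balls he
  have hev : ∀ᶠ t in l, ∀ x ∈ N, |F t x - Φ x| < τ / 3 := by
    rw [hNf.eventually_all]
    intro x _
    have := (Metric.tendsto_nhds.1 (hl x)) (τ / 3) (by positivity)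
    simpa [Real.dist_eq] using this
  filter_upwards [hev] with t ht p hp
  have hpK : p ∈ {p : ↥(oS n) | ∀ i, c ≤ p.1 i} := hp
  obtain ⟨x, hxN, hpx⟩ := Set.mem_iUnion₂.1 (hcov hpK)
  have hd : dist p x < τ / (3 * (L + 1)) := hpx
  have hxK := hNK hxN
  have h1 := hF t c hc x p hxK hp
  have h2 := hΦ c hc x p hxK hp
  have h3 := ht x hxN
  rw [dist_comm x p] at h1 h2
  have h4 : L * dist p x ≤ τ / 3 := by
    calc L * dist p x ≤ (L + 1) * (τ / (3 * (L + 1))) :=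
          mul_le_mul (by linarith) hd.le dist_nonneg (by linarith)
      _ = τ / 3 := by field_simp
  have h5 : F t p - Φ p = (F t p - F t x) + (F t x - Φ x) - (Φ p - Φ x) := by ring
  rw [h5, abs_le]
  have a1 := abs_le.1 (h1.trans h4)
  have a2 := abs_le.1 (h2.trans h4)
  have a3 := abs_lt.1 h3
  constructor <;> linarith

/-- The error function. -/
def Ej {n : ℕ} {M : ℝ} (Φ : ↥(oS n) → ℝ) (h : ℝ) (x : ↥(Sset n M)) : ℝ :=
  |(2 * extZ Φ x.1.1 - extZ Φ (x.1.1 + (-h) • (x.1.2 - x.1.1))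
    - extZ Φ (x.1.1 + h • (x.1.2 - x.1.1))) / h| / extZ Φ x.1.1

/-- The test function. -/
def Fj {n : ℕ} {M : ℝ} (Φ : ↥(oS n) → ℝ) (j : ℕ) (x : ↥(Sset n M)) : ℝ :=
  min M (Ej Φ (1 / (2 * M * (j + 1))) x) + M * min 1 (1 / ((j + 1) * ∏ i, x.1.1 i))

lemma hj_bound {M : ℝ} (hM : 1 ≤ M) (j : ℕ) :
    |1 / (2 * M * ((j : ℝ) + 1))| ≤ 1 / (2 * M) := by
  rw [abs_of_nonneg (by positivity)]
  refine one_div_le_one_div_of_le (by positivity) ?_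
  have : (0 : ℝ) ≤ j := by positivity
  nlinarith

lemma Ej_nonneg {n : ℕ} {M : ℝ} {Φ : ↥(oS n) → ℝ} (hpos : ∀ p, 0 < Φ p) (h : ℝ)
    (x : ↥(Sset n M)) : 0 ≤ Ej Φ h x := by
  refine div_nonneg (abs_nonneg _) ?_
  rw [extZ_of_mem Φ ⟨x.1.1, x.2.1⟩]
  exact (hpos _).le

lemma prodS_pos {n : ℕ} {M : ℝ} (x : ↥(Sset n M)) : 0 < ∏ i, x.1.1 i :=
  Finset.prod_pos fun i _ => x.2.1.1 i

lemma Fj_bounds {n : ℕ} {M : ℝ} (hM : 1 ≤ M) {Φ : ↥(oS n) → ℝ} (hpos : ∀ p, 0 < Φ p) (j : ℕ)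
    (x : ↥(Sset n M)) : 0 ≤ Fj Φ j x ∧ Fj Φ j x ≤ 2 * M := by
  have h1 := Ej_nonneg hpos (1 / (2 * M * ((j : ℝ) + 1))) x
  have h2 := prodS_pos x
  have h3 : 0 ≤ min 1 (1 / (((j : ℝ) + 1) * ∏ i, x.1.1 i)) := le_min zero_le_one (by positivity)
  have h4 : min 1 (1 / (((j : ℝ) + 1) * ∏ i, x.1.1 i)) ≤ 1 := min_le_left _ _
  have h5 : min M (Ej Φ (1 / (2 * M * ((j : ℝ) + 1))) x) ≤ M := min_le_left _ _
  have h6 : 0 ≤ min M (Ej Φ (1 / (2 * M * ((j : ℝ) + 1))) x) := le_min (by linarith) h1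
  unfold Fj
  constructor <;> nlinarith

lemma cont_seg {n : ℕ} {M : ℝ} (hM : 1 ≤ M) {Φ : ↥(oS n) → ℝ} (hΦ : Continuous Φ) (r : ℝ)
    (hr : |r| ≤ 1 / (2 * M)) :
    Continuous fun x : ↥(Sset n M) => extZ Φ (x.1.1 + r • (x.1.2 - x.1.1)) := by
  have e : (fun x : ↥(Sset n M) => extZ Φ (x.1.1 + r • (x.1.2 - x.1.1))) =
      fun x : ↥(Sset n M) => Φ ⟨x.1.1 + r • (x.1.2 - x.1.1), (seg_mem hM _ _ x.2 r hr).2⟩ := by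
    funext x
    exact extZ_of_mem Φ ⟨x.1.1 + r • (x.1.2 - x.1.1), (seg_mem hM _ _ x.2 r hr).2⟩
  rw [e]
  refine hΦ.comp (Continuous.subtype_mk ?_ _)
  fun_prop

lemma Fj_cont {n : ℕ} {M : ℝ} (hM : 1 ≤ M) {Φ : ↥(oS n) → ℝ} (hΦ : Continuous Φ)
    (hpos : ∀ p, 0 < Φ p) (j : ℕ) : Continuous (Fj Φ j : ↥(Sset n M) → ℝ) := by
  have hh := hj_bound hM j
  have c1 := cont_seg hM hΦ _ hh
  have c2 := cont_seg hM hΦ (-(1 / (2 * M * ((j : ℝ) + 1)))) (by rwa [abs_neg])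
  have c0 := cont_seg hM hΦ 0 (by rw [abs_zero]; positivity)
  simp only [zero_smul, add_zero] at c0
  have hp0 : ∀ x : ↥(Sset n M), extZ Φ x.1.1 ≠ 0 := fun x => by
    rw [extZ_of_mem Φ ⟨x.1.1, x.2.1⟩]; exact (hpos _).ne'
  unfold Fj Ej
  refine (continuous_const.min ?_).add (continuous_const.mul (continuous_const.min ?_))
  · refine Continuous.div ?_ c0 hp0
    exact ((((continuous_const.mul c0).sub c2).sub c1).div_const _).abs
  · refine continuous_const.div ?_ fun x => ?_
    · exact continuous_const.mul (continuous_finsetProd _ fun i _ => by fun_prop)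
    · have := prodS_pos x
      positivity

lemma Fj_int {n : ℕ} (hn : 2 ≤ n) {M : ℝ} (hM : 1 ≤ M) {Φ : ↥(oS n) → ℝ} (hΦ : LLip Φ)
    (hpos : ∀ p, 0 < Φ p) (P : Measure ↥(Sset n M)) [IsProbabilityMeasure P]
    (hP : P.map Subtype.val ≪ Measure.hausdorffMeasure (2 * (n : ℝ) - 2)) :
    Tendsto (fun j : ℕ => ∫ x, Fj Φ j x ∂P) atTop (𝓝 0) := by
  have h := tendsto_integral_of_dominated_convergence (μ := P)
    (F := fun j : ℕ => (Fj Φ j : ↥(Sset n M) → ℝ)) (f := fun _ => (0 : ℝ)) (fun _ => 2 * M)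
    (fun j => (Fj_cont hM hΦ.continuous hpos j).measurable.aestronglyMeasurable)
    (integrable_const _)
    (fun j => Filter.Eventually.of_forall fun x => by
      rw [Real.norm_eq_abs, abs_of_nonneg (Fj_bounds hM hpos j x).1]
      exact (Fj_bounds hM hpos j x).2) ?_
  · simpa using h
  filter_upwards [rad_P hn hΦ P hP] with x hx
  have hj0 : Tendsto (fun j : ℕ => 1 / ((j : ℝ) + 1)) atTop (𝓝 0) :=
    tendsto_one_div_add_atTop_nhds_zero_nat
  have hh : Tendsto (fun j : ℕ => 1 / (2 * M * ((j : ℝ) + 1))) atTop (𝓝[≠] 0) := by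
    refine tendsto_nhdsWithin_iff.2 ⟨?_, Filter.Eventually.of_forall fun j => ?_⟩
    · have := hj0.const_mul (1 / (2 * M))
      rw [mul_zero] at this
      refine this.congr fun j => ?_
      field_simp
    · have : (0 : ℝ) < 1 / (2 * M * ((j : ℝ) + 1)) := by positivity
      exact this.ne'
  have hE : Tendsto (fun j : ℕ => Ej Φ (1 / (2 * M * ((j : ℝ) + 1))) x) atTop (𝓝 0) := by
    have := ((hx.comp hh).abs).div_const (extZ Φ x.1.1)
    rw [abs_zero, zero_div] at this
    exact this
  have hχ : Tendsto (fun j : ℕ => 1 / (((j : ℝ) + 1) * ∏ i, x.1.1 i)) atTop (𝓝 0) := by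
    have := hj0.div_const (∏ i, x.1.1 i)
    rw [zero_div] at this
    refine this.congr fun j => ?_
    rw [div_div]
  have h1 := (tendsto_const_nhds (x := M)).min hE
  have h2 := ((tendsto_const_nhds (x := (1 : ℝ))).min hχ).const_mul M
  have h3 := h1.add h2
  have e : min M 0 + M * min 1 0 = 0 := by
    rw [min_eq_right (by linarith), min_eq_right zero_le_one]; simp
  rw [e] at h3
  exact h3

/-- One-step comparison with the test function. -/
lemma cmp_Fj {n : ℕ} (hn : 2 ≤ n) {M : ℝ} (hM : 1 ≤ M) {π π' : ↥(oS n) → ↥(cS n)}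
    {Φ₁ Φ₂ Φ : ↥(oS n) → ℝ}
    (g₁ : IsGen π Φ₁) (g₂ : IsGen π' Φ₂) (hpos : ∀ p, 0 < Φ p) (hN : ∀ p, Φ p ≤ n)
    (hge : ∀ c : ℝ, 0 < c → ∀ p : ↥(oS n), (∀ i, c ≤ p.1 i) → c ≤ Φ p)
    (j : ℕ) {c τ h : ℝ} (hc : c = 1 / (2 * ((j : ℝ) + 1))) (hh : h = 1 / (2 * M * ((j : ℝ) + 1)))
    (hτ : 0 ≤ τ)
    (t1 : ∀ p : ↥(oS n), (∀ i, c ≤ p.1 i) → |Φ₁ p - Φ p| ≤ τ)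
    (t2 : ∀ p : ↥(oS n), (∀ i, c ≤ p.1 i) → |Φ₂ p - Φ p| ≤ τ)
    (p q : ↥(oS n)) (hpq : (p.1, q.1) ∈ Sset n M) :
    Rr π p q - Rr π' p q ≤ Fj Φ j (⟨(p.1, q.1), hpq⟩ : ↥(Sset n M))
      + 2 * (τ / c + n * τ / c ^ 2) / h := by
  have hc0 : 0 < c := by rw [hc]; positivity
  have hh0 : 0 < h := by rw [hh]; positivity
  have b1 := Rr_bounds π p q hpq
  have b2 := Rr_bounds π' p q hpq
  have hM1 : 0 < 1 / M := by positivity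
  have hdM : Rr π p q - Rr π' p q ≤ M := by linarith [b1.2, b2.1]
  have herr : 0 ≤ 2 * (τ / c + n * τ / c ^ 2) / h := by positivity
  have hE0 := Ej_nonneg hpos h (⟨(p.1, q.1), hpq⟩ : ↥(Sset n M))
  have hprod : 0 < ∏ i, p.1 i := Finset.prod_pos fun i _ => p.2.1 i
  unfold Fj
  rw [← hh]
  simp only
  have hm0 : 0 ≤ min M (Ej Φ h (⟨(p.1, q.1), hpq⟩ : ↥(Sset n M))) := le_min (by linarith) hE0
  by_cases hcase : 1 ≤ 1 / (((j : ℝ) + 1) * ∏ i, p.1 i)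
  · rw [min_eq_left hcase]
    linarith
  · push Not at hcase
    have hj : (0 : ℝ) < (j : ℝ) + 1 := by positivity
    rw [div_lt_one (by positivity)] at hcase
    have hpi : ∀ i, 2 * c ≤ p.1 i := by
      intro i
      refine le_trans ?_ (prod_le_coord p i)
      rw [hc]
      have : 2 * (1 / (2 * ((j : ℝ) + 1))) = 1 / ((j : ℝ) + 1) := by field_simp
      rw [this, div_le_iff₀ hj]
      linarith
    have hhb : |h| ≤ 1 / (2 * M) := by rw [hh]; exact hj_bound hM j
    have sx := seg_mem hM p.1 q.1 hpq (-h) (by rwa [abs_neg])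
    have sy := seg_mem hM p.1 q.1 hpq h hhb
    have hpc : ∀ i, c ≤ p.1 i := fun i => by linarith [hpi i]
    have hxc : ∀ i, c ≤ (p.1 + (-h) • (q.1 - p.1)) i := fun i => by linarith [hpi i, sx.1 i]
    have hyc : ∀ i, c ≤ (p.1 + h • (q.1 - p.1)) i := fun i => by linarith [hpi i, sy.1 i]
    have key := cmp_step (Φ := Φ) g₁ g₂ p q ⟨_, sx.2⟩ ⟨_, sy.2⟩ hh0 rfl rfl hc0
      (hge c hc0 p hpc) (gen_ge hn g₁ p c hc0 hpc) (gen_ge hn g₂ p c hc0 hpc)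
      (hpos _).le (hN _) (hpos _).le (hN _) (t1 p hpc) (t1 ⟨_, sx.2⟩ hxc) (t2 p hpc)
      (t2 ⟨_, sy.2⟩ hyc)
    have eE : Ej Φ h (⟨(p.1, q.1), hpq⟩ : ↥(Sset n M)) =
        |(2 * Φ p - Φ ⟨_, sx.2⟩ - Φ ⟨_, sy.2⟩) / h| / Φ p := by
      unfold Ej
      simp only
      rw [extZ_of_mem Φ p, extZ_of_mem Φ ⟨_, sx.2⟩, extZ_of_mem Φ ⟨_, sy.2⟩]
    rw [← eE] at key
    have h3 : 0 ≤ M * min 1 (1 / (((j : ℝ) + 1) * ∏ i, p.1 i)) :=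
      mul_nonneg (by linarith) (le_min zero_le_one (by positivity))
    rcases min_cases M (Ej Φ h (⟨(p.1, q.1), hpq⟩ : ↥(Sset n M))) with hh | hh
    · rw [hh.1]; linarith
    · rw [hh.1]; linarith

lemma upper {n : ℕ} (hn : 2 ≤ n) (D : ℕ → ↥(FGset n)) (Ψ : ℕ → ↥(oS n) → ℝ)
    (hD : ∀ k, IsGen (UniformFun.toFun (D k).1) (Ψ k))
    (hdense : ∀ (π : ↥(FGset n)) (Φ : ↥(oS n) → ℝ), IsGen (UniformFun.toFun π.1) Φ →
      ∀ c : ℝ, 0 < c → ∀ τ : ℝ, 0 < τ → ∃ k, ∀ p : ↥(oS n), (∀ i, c ≤ p.1 i) →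
        |Ψ k p - Φ p| ≤ τ)
    {M : ℝ} (hM : 1 ≤ M) (μ : ℕ → ↥(oS n))
    (hS : ∀ s : ℕ, ((μ s : Fin n → ℝ), (μ (s + 1) : Fin n → ℝ)) ∈ Sset n M)
    (P : Measure ↥(Sset n M)) [IsProbabilityMeasure P]
    (hP : P.map Subtype.val ≪ Measure.hausdorffMeasure (2 * (n : ℝ) - 2))
    (hw : ∀ f : BoundedContinuousFunction ↥(Sset n M) ℝ,
          Tendsto (fun t : ℕ =>
              (∑ s ∈ Finset.range t,
                f ⟨((μ s : Fin n → ℝ), (μ (s + 1) : Fin n → ℝ)), hS s⟩) / t)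
            atTop (𝓝 (∫ x, f x ∂P)))
    (W : ↥(FGset n) → ℝ)
    (hW : ∀ k : ℕ,
            Tendsto (fun t : ℕ => Real.log (pV μ (UniformFun.toFun (D k).1) t) / t)
              atTop (𝓝 (W (D k))))
    (W0 : ℝ) (hW0 : ∀ k, W (D k) ≤ W0) (ε : ℝ) (hε : 0 < ε) :
    ∀ᶠ t : ℕ in atTop, ∀ π : ↥(FGset n),
      Real.log (pV μ (UniformFun.toFun π.1) t) / t ≤ W0 + ε := by
  by_contra hcon
  set T : Set ℕ := {t : ℕ | ¬ ∀ π : ↥(FGset n),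
      Real.log (pV μ (UniformFun.toFun π.1) t) / t ≤ W0 + ε} with hT
  have hfreq : ∃ᶠ t in atTop, t ∈ T := Filter.not_eventually.1 hcon
  have hne : (atTop ⊓ 𝓟 T).NeBot := frequently_mem_iff_neBot.1 hfreq
  let U : Ultrafilter ℕ := Ultrafilter.of (atTop ⊓ 𝓟 T)
  have hUle : (U : Filter ℕ) ≤ atTop ⊓ 𝓟 T := Ultrafilter.of_le _
  have hUa : (U : Filter ℕ) ≤ atTop := hUle.trans inf_le_left
  have hUT : ∀ᶠ t in (U : Filter ℕ), t ∈ T := (hUle.trans inf_le_right) (mem_principal_self T)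
  have hch : ∀ t : ℕ, ∃ π : ↥(FGset n), t ∈ T →
      W0 + ε < Real.log (pV μ (UniformFun.toFun π.1) t) / t := by
    intro t
    by_cases ht : t ∈ T
    · have : ¬ ∀ π : ↥(FGset n),
        Real.log (pV μ (UniformFun.toFun π.1) t) / t ≤ W0 + ε := ht
      push Not at this
      obtain ⟨π, hπ⟩ := this
      exact ⟨π, fun _ => hπ⟩
    · exact ⟨D 0, fun h => absurd h ht⟩
  choose Q hQ using hch
  choose F hF using fun t => exists_gen hn (UniformFun.toFun (Q t).1) (Q t).2
  have hlim : ∀ p, ∃ y : ℝ, Tendsto (fun t => F t p) (U : Filter ℕ) (𝓝 y) := by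
    intro p
    have hmem : ∀ t, F t p ∈ Set.Icc (0 : ℝ) n := fun t => ⟨((hF t).1 p).le, gen_le hn (hF t) p⟩
    obtain ⟨y, -, hy⟩ := (isCompact_Icc (a := (0 : ℝ)) (b := (n : ℝ))).ultrafilter_le_nhds
      (U.map fun t => F t p) (by
        rw [le_principal_iff]
        exact Filter.mem_map.2 (Filter.univ_mem' hmem))
    exact ⟨y, hy⟩
  choose Φ hΦ using hlim
  have hge : ∀ c : ℝ, 0 < c → ∀ p : ↥(oS n), (∀ i, c ≤ p.1 i) → c ≤ Φ p := fun c hc p hp =>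
    ge_of_tendsto' (hΦ p) fun t => gen_ge hn (hF t) p c hc hp
  have hpos : ∀ p, 0 < Φ p := fun p => by
    obtain ⟨c, hc, hp⟩ := exists_lb p
    exact hc.trans_le (hge c hc p fun i => (hp i).le)
  have hN : ∀ p, Φ p ≤ n := fun p => le_of_tendsto' (hΦ p) fun t => gen_le hn (hF t) p
  have hLip : LLip Φ := fun c hc p q hp hq =>
    le_of_tendsto' ((hΦ q).sub (hΦ p)).abs fun t => gen_llip hn (hF t) c hc p q hp hq
  have hM0 : 0 < M := by linarith
  have hint := Fj_int hn hM hLip hpos P hP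
  have hε4 : 0 < ε / (4 * M) := by positivity
  obtain ⟨j, hj⟩ := (hint.eventually_lt_const hε4).exists
  obtain ⟨c, hc⟩ : ∃ c : ℝ, c = 1 / (2 * ((j : ℝ) + 1)) := ⟨_, rfl⟩
  obtain ⟨h, hh⟩ : ∃ h : ℝ, h = 1 / (2 * M * ((j : ℝ) + 1)) := ⟨_, rfl⟩
  have hc0 : 0 < c := by rw [hc]; positivity
  have hh0 : 0 < h := by rw [hh]; positivity
  obtain ⟨A, hA⟩ : ∃ A : ℝ, A = 2 * (1 / c + n * 1 / c ^ 2) / h := ⟨_, rfl⟩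
  have hA0 : 0 < A := by rw [hA]; positivity
  obtain ⟨τ, hτe⟩ : ∃ τ : ℝ, τ = ε / (4 * M) / A := ⟨_, rfl⟩
  have hτ : 0 < τ := by rw [hτe]; positivity
  have herr : 2 * (τ / c + n * τ / c ^ 2) / h = ε / (4 * M) := by
    have : 2 * (τ / c + n * τ / c ^ 2) / h = A * τ := by rw [hA]; ring
    rw [this, hτe]; field_simp
  have hun := unif_of_ptwise (fun t => gen_llip hn (hF t)) hLip hΦ hc0 (half_pos hτ)
  obtain ⟨t0, ht0⟩ := hun.exists
  obtain ⟨k, hk⟩ := hdense (Q t0) (F t0) (hF t0) c hc0 (τ / 2) (half_pos hτ)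
  have hk2 : ∀ p : ↥(oS n), (∀ i, c ≤ p.1 i) → |Ψ k p - Φ p| ≤ τ := by
    intro p hp
    have a1 := abs_le.1 (hk p hp)
    have a2 := abs_le.1 (ht0 p hp)
    rw [abs_le]; constructor <;> linarith
  let fb : BoundedContinuousFunction ↥(Sset n M) ℝ :=
    BoundedContinuousFunction.ofNormedAddCommGroup (Fj Φ j)
      (Fj_cont hM hLip.continuous hpos j) (2 * M) (fun x => by
        rw [Real.norm_eq_abs, abs_of_nonneg (Fj_bounds hM hpos j x).1]
        exact (Fj_bounds hM hpos j x).2)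
  have hfb : ∀ x, fb x = Fj Φ j x := fun x => rfl
  have hav := (hw fb).mono_left hUa
  simp only [hfb] at hav
  have ev1 := hav.eventually_lt_const hj
  have ev2 := ((hW k).mono_left hUa).eventually_lt_const
    (show W (D k) < W0 + ε / 4 by linarith [hW0 k])
  have ev3 : ∀ᶠ t in (U : Filter ℕ), 0 < t := hUa (eventually_gt_atTop 0)
  obtain ⟨t, h1, h2, h3, h4, h5⟩ := (ev1.and (ev2.and (ev3.and (hUT.and hun)))).exists
  have hbig := hQ t h4
  have ht0' : (0 : ℝ) < t := by exact_mod_cast h3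
  have hstep : ∀ s, Real.log (Rr (UniformFun.toFun (Q t).1) (μ s) (μ (s + 1)))
      - Real.log (Rr (UniformFun.toFun (D k).1) (μ s) (μ (s + 1))) ≤
      M * (Fj Φ j ⟨((μ s : Fin n → ℝ), (μ (s + 1) : Fin n → ℝ)), hS s⟩ + ε / (4 * M)) := by
    intro s
    have b1 := Rr_bounds (UniformFun.toFun (Q t).1) _ _ (hS s)
    have b2 := Rr_bounds (UniformFun.toFun (D k).1) _ _ (hS s)
    have := cmp_Fj hn hM (hF t) (hD k) hpos hN hge j hc hh hτ.le
      (fun p hp => (h5 p hp).trans (by linarith)) hk2 (μ s) (μ (s + 1)) (hS s)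
    rw [herr] at this
    exact log_step hM0 (lt_of_lt_of_le (by positivity) b1.1) b2.1
      (add_nonneg (Fj_bounds hM hpos j _).1 hε4.le) this
  have hsum := Finset.sum_le_sum fun s (_ : s ∈ Finset.range t) => hstep s
  rw [Finset.sum_sub_distrib, ← log_pV hM μ hS, ← log_pV hM μ hS, ← Finset.mul_sum,
    Finset.sum_add_distrib, Finset.sum_const, Finset.card_range, nsmul_eq_mul] at hsum
  rw [lt_div_iff₀ ht0'] at hbig
  rw [div_lt_iff₀ ht0'] at h1 h2
  have e1 : M * (ε / (4 * M)) = ε / 4 := by field_simp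
  have h1' := mul_lt_mul_of_pos_left h1 hM0
  have e2 : M * (ε / (4 * M) * t) = ε / 4 * t := by rw [← mul_assoc, e1]
  have e3 : M * (t * (ε / (4 * M))) = ε / 4 * t := by rw [mul_comm (t : ℝ), e2]
  rw [mul_add, e3] at hsum
  rw [e2] at h1'
  have : 0 < ε * t := by positivity
  linarith

lemma locCpt_oS (n : ℕ) : LocallyCompactSpace ↥(oS n) := by
  have e : oS n = {p : Fin n → ℝ | ∀ i, 0 < p i} ∩ {p : Fin n → ℝ | ∑ i, p i = 1} := rfl
  have h1 : IsOpen {p : Fin n → ℝ | ∀ i, 0 < p i} := by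
    simp only [Set.ofPred_forall]
    exact isOpen_iInter_of_finite fun i => isOpen_lt continuous_const (continuous_apply i)
  have h2 : IsClosed {p : Fin n → ℝ | ∑ i, p i = 1} :=
    isClosed_eq (continuous_finsetSum _ fun i _ => continuous_apply i) continuous_const
  have : IsLocallyClosed (oS n) := ⟨_, _, h1, h2, e⟩
  exact this.locallyCompactSpace

/-- The market portfolio is functionally generated. -/
lemma market_FG (n : ℕ) : ∃ π : ↥(FGset n), True := by
  let m : ↥(oS n) → ↥(cS n) := fun p => ⟨p.1, fun i => (p.2.1 i).le, p.2.2⟩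
  have hm : IsFG m := by
    refine ⟨fun _ => 1, fun _ _ => one_pos, ?_, fun p q => ?_⟩
    · refine concaveOn_const _ ?_
      intro x hx y hy a b ha hb hab
      refine ⟨fun i => ?_, ?_⟩
      · have h1 := hx.1 i
        have h2 := hy.1 i
        simp only [Pi.add_apply, Pi.smul_apply, smul_eq_mul]
        rcases ha.eq_or_lt with rfl | ha'
        · have : b = 1 := by linarith
          subst this; simpa using h2
        · have := mul_pos ha' h1
          have := mul_nonneg hb h2.le
          linarith
      · simp only [Pi.add_apply, Pi.smul_apply, smul_eq_mul, Finset.sum_add_distrib,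
          ← Finset.mul_sum, hx.2, hy.2, mul_one, hab]
    · have : ∀ i, (m p).1 i * (q.1 i / p.1 i) = q.1 i := fun i => by
        have := (p.2.1 i).ne'
        change p.1 i * (q.1 i / p.1 i) = _
        field_simp
      rw [Finset.sum_congr rfl fun i _ => this i, q.2.2]
      simp
  exact ⟨⟨UniformFun.ofFun m, hm⟩, trivial⟩

lemma exists_dense {n : ℕ} (hn : 2 ≤ n) : ∃ (D : ℕ → ↥(FGset n)) (Ψ : ℕ → ↥(oS n) → ℝ),
    (∀ k, IsGen (UniformFun.toFun (D k).1) (Ψ k)) ∧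
    (∀ (π : ↥(FGset n)) (Φ : ↥(oS n) → ℝ), IsGen (UniformFun.toFun π.1) Φ →
      ∀ c : ℝ, 0 < c → ∀ τ : ℝ, 0 < τ → ∃ k, ∀ p : ↥(oS n), (∀ i, c ≤ p.1 i) →
        |Ψ k p - Φ p| ≤ τ) := by
  haveI := locCpt_oS n
  let G : Set C(↥(oS n), ℝ) := {f | ∃ π : ↥(FGset n), IsGen (UniformFun.toFun π.1) f}
  have hG : ∀ (π : ↥(FGset n)) (Φ : ↥(oS n) → ℝ) (h : IsGen (UniformFun.toFun π.1) Φ),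
      (⟨Φ, (gen_llip hn h).continuous⟩ : C(↥(oS n), ℝ)) ∈ G := fun π Φ h => ⟨π, h⟩
  obtain ⟨π0, -⟩ := market_FG n
  obtain ⟨Φ0, hΦ0⟩ := exists_gen hn _ π0.2
  haveI : Nonempty ↥G := ⟨⟨_, hG π0 Φ0 hΦ0⟩⟩
  let d : ℕ → ↥G := TopologicalSpace.denseSeq ↥G
  have hd : DenseRange d := TopologicalSpace.denseRange_denseSeq _
  choose D hD using fun k => (d k).2
  refine ⟨D, fun k => (d k).1, hD, ?_⟩
  intro π Φ h c hc τ hτ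
  let x : ↥G := ⟨_, hG π Φ h⟩
  have hid : Tendsto (fun y : ↥G => y.1) (𝓝 x) (𝓝 x.1) := continuous_subtype_val.tendsto x
  rw [ContinuousMap.tendsto_iff_forall_isCompact_tendstoUniformlyOn] at hid
  have hu := Metric.tendstoUniformlyOn_iff.1 (hid _ (isCompact_Kc (n := n) hc)) τ hτ
  obtain ⟨k, hk⟩ := hd.exists_mem_open isOpen_interior ⟨x, mem_interior_iff_mem_nhds.2 hu⟩
  refine ⟨k, fun p hp => ?_⟩
  have := interior_subset hk
  have h2 : dist (Φ p) ((d k).1 p) < τ := this p hp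
  rw [dist_comm, Real.dist_eq] at h2
  exact h2.le

instance {n : ℕ} : BorelSpace (↥(oS n) →ᵤ ↥(cS n)) := ⟨rfl⟩

lemma pV_cont {n : ℕ} (μ : ℕ → ↥(oS n)) (t : ℕ) :
    Continuous fun π : ↥(FGset n) => pV μ (UniformFun.toFun π.1) t := by
  induction t with
  | zero => simpa [pV, relV] using continuous_const
  | succ t ih =>
    simp only [pV_succ]
    refine ih.mul ?_
    unfold Rr
    refine continuous_finsetSum _ fun i _ => Continuous.mul ?_ continuous_const
    have h1 : Continuous fun π : ↥(FGset n) => UniformFun.toFun π.1 (μ t) :=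
      (UniformFun.uniformContinuous_eval _ (μ t)).continuous.comp continuous_subtype_val
    exact (continuous_apply i).comp (continuous_subtype_val.comp h1)

lemma log_div_tendsto_zero (a : ℝ) : Tendsto (fun t : ℕ => a / (t : ℝ)) atTop (𝓝 0) :=
  tendsto_const_div_atTop_nhds_zero_nat a

/-- Theorem 1.3(iii), universality: there is an initial distribution `ν₀` on
`FG` such that, for every market path satisfying Assumption (M) whose empirical measures
converge weakly to an absolutely continuous probability measure on `S`, one has
`sup_{π ∈ supp ν₀} W(π) = sup_{π ∈ FG} W(π) = W*`, and Cover's portfolio built from `ν₀`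
satisfies `lim (1/t) log V̂(t) = lim (1/t) log V*(t) = W*`; in particular
`(1/t) log (V̂(t)/V*(t)) → 0`. -/
theorem stmt3 {n : ℕ} (hn : 2 ≤ n) :
    ∃ ν0 : Measure ↥(FGset n), IsProbabilityMeasure ν0 ∧
      ∀ (M : ℝ), 0 < M →
      ∀ (μ : ℕ → ↥(oS n))
        (hS : ∀ s : ℕ, ((μ s : Fin n → ℝ), (μ (s + 1) : Fin n → ℝ)) ∈ Sset n M)
        (P : Measure ↥(Sset n M)), IsProbabilityMeasure P →
        P.map Subtype.val ≪ Measure.hausdorffMeasure (2 * (n : ℝ) - 2) →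
        (∀ f : BoundedContinuousFunction ↥(Sset n M) ℝ,
          Tendsto (fun t : ℕ =>
              (∑ s ∈ Finset.range t,
                f ⟨((μ s : Fin n → ℝ), (μ (s + 1) : Fin n → ℝ)), hS s⟩) / t)
            atTop (𝓝 (∫ x, f x ∂P))) →
        ∀ W : ↥(FGset n) → ℝ,
          (∀ π : ↥(FGset n),
            Tendsto (fun t : ℕ => Real.log (pV μ (UniformFun.toFun π.1) t) / t)
              atTop (𝓝 (W π))) →
          (⨆ π : ↥(msupp ν0), W π.1) = (⨆ π : ↥(FGset n), W π) ∧
          Tendsto (fun t : ℕ =>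
              Real.log (∫ π : ↥(FGset n), pV μ (UniformFun.toFun π.1) t ∂ν0) / t)
            atTop (𝓝 (⨆ π : ↥(FGset n), W π)) ∧
          Tendsto (fun t : ℕ =>
              Real.log (⨆ π : ↥(FGset n), pV μ (UniformFun.toFun π.1) t) / t)
            atTop (𝓝 (⨆ π : ↥(FGset n), W π)) ∧
          Tendsto (fun t : ℕ =>
              Real.log ((∫ π : ↥(FGset n), pV μ (UniformFun.toFun π.1) t ∂ν0) /
                (⨆ π : ↥(FGset n), pV μ (UniformFun.toFun π.1) t)) / t)
            atTop (𝓝 0) := by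
  classical
  obtain ⟨D, Ψ, hD, hdense⟩ := exists_dense hn
  have hDm : Measurable D := measurable_from_nat
  let m : Measure ℕ := ProbabilityTheory.poissonMeasure 1
  have hm : ∀ k, 0 < m {k} := by
    intro k
    simp only [m]
    rw [ProbabilityTheory.poissonMeasure_singleton]
    rw [ENNReal.ofReal_pos]
    positivity
  haveI : IsProbabilityMeasure (m.map D) := Measure.isProbabilityMeasure_map hDm.aemeasurable
  refine ⟨m.map D, inferInstance, ?_⟩
  intro M _ μ hS P hPp hP hw W hW
  have hM : 1 ≤ M := one_le_M _ _ (hS 0)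
  have hM0 : 0 < M := by linarith
  have hVb := pV_bounds hM μ hS
  -- bounds on `W`
  have hWle : ∀ π, W π ≤ Real.log M := by
    intro π
    refine le_of_tendsto (hW π) ?_
    filter_upwards [eventually_gt_atTop 0] with t ht
    have ht' : (0 : ℝ) < t := by exact_mod_cast ht
    rw [div_le_iff₀ ht', mul_comm, ← Real.log_pow]
    exact Real.log_le_log (hVb _ t).1 (hVb _ t).2
  have hbW : BddAbove (Set.range W) := ⟨Real.log M, by rintro _ ⟨π, rfl⟩; exact hWle π⟩
  have hbD : BddAbove (Set.range fun k => W (D k)) :=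
    ⟨Real.log M, by rintro _ ⟨k, rfl⟩; exact hWle _⟩
  set W0 : ℝ := ⨆ k, W (D k) with hW0
  have hk0 : ∀ k, W (D k) ≤ W0 := fun k => le_ciSup hbD k
  have hup := upper hn D Ψ hD hdense hM μ hS P hP hw W (fun k => hW (D k)) W0 hk0
  have hWW0 : ∀ π, W π ≤ W0 := by
    intro π
    refine le_of_forall_pos_le_add fun ε hε => ?_
    refine le_of_tendsto (hW π) ?_
    filter_upwards [hup ε hε] with t ht using ht π
  haveI : Nonempty ↥(FGset n) := ⟨D 0⟩
  have hstar : (⨆ π : ↥(FGset n), W π) = W0 :=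
    le_antisymm (ciSup_le hWW0) (ciSup_le fun k => le_ciSup hbW (D k))
  have hsupp : ∀ k, D k ∈ msupp (m.map D) := by
    intro k O hO hk
    rw [Measure.map_apply hDm hO.measurableSet]
    refine (hm k).trans_le (measure_mono ?_)
    rintro _ rfl
    exact hk
  have hms : (⨆ π : ↥(msupp (m.map D)), W π.1) = W0 := by
    haveI : Nonempty ↥(msupp (m.map D)) := ⟨⟨D 0, hsupp 0⟩⟩
    refine le_antisymm (ciSup_le fun π => hWW0 _) (ciSup_le fun k => ?_)
    exact le_ciSup (f := fun π : ↥(msupp (m.map D)) => W π.1)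
      ⟨Real.log M, by rintro _ ⟨π, rfl⟩; exact hWle _⟩ ⟨D k, hsupp k⟩
  rw [hms, hstar]
  have hbV : ∀ t, BddAbove (Set.range fun π : ↥(FGset n) => pV μ (UniformFun.toFun π.1) t) :=
    fun t => ⟨M ^ t, by rintro _ ⟨π, rfl⟩; exact (hVb _ t).2⟩
  have hint : ∀ t, Integrable (fun π : ↥(FGset n) => pV μ (UniformFun.toFun π.1) t)
      (m.map D) := by
    intro t
    refine Integrable.of_bound (pV_cont μ t).measurable.aestronglyMeasurable (M ^ t)
      (Filter.Eventually.of_forall fun π => ?_)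
    rw [Real.norm_eq_abs, abs_of_pos (hVb _ t).1]
    exact (hVb _ t).2
  set Vh : ℕ → ℝ := fun t => ∫ π : ↥(FGset n), pV μ (UniformFun.toFun π.1) t ∂(m.map D) with hVh
  set Vs : ℕ → ℝ := fun t => ⨆ π : ↥(FGset n), pV μ (UniformFun.toFun π.1) t with hVs
  have hle : ∀ t, Vh t ≤ Vs t := by
    intro t
    have h1 := integral_mono (hint t) (integrable_const (Vs t))
      (fun π => le_ciSup (hbV t) π)
    simpa using h1
  have hlow : ∀ k t, (m {k}).toReal * pV μ (UniformFun.toFun (D k).1) t ≤ Vh t := by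
    intro k t
    have e : Vh t = ∫ j, pV μ (UniformFun.toFun (D j).1) t ∂m :=
      integral_map hDm.aemeasurable (pV_cont μ t).measurable.aestronglyMeasurable
    have hi : Integrable (fun j => pV μ (UniformFun.toFun (D j).1) t) m :=
      (hint t).comp_measurable hDm
    rw [e]
    have h1 := setIntegral_le_integral (s := {k}) hi
      (Filter.Eventually.of_forall fun j => (hVb _ t).1.le)
    rw [integral_singleton, smul_eq_mul] at h1
    exact h1
  have hmk : ∀ k, 0 < (m {k}).toReal := fun k =>
    ENNReal.toReal_pos (hm k).ne' (measure_ne_top _ _)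
  have hVh0 : ∀ t, 0 < Vh t := fun t => (mul_pos (hmk 0) (hVb _ t).1).trans_le (hlow 0 t)
  have hVs0 : ∀ t, 0 < Vs t := fun t => (hVh0 t).trans_le (hle t)
  have hlogle : ∀ t : ℕ, Real.log (Vh t) / t ≤ Real.log (Vs t) / t := fun t =>
    div_le_div_of_nonneg_right (Real.log_le_log (hVh0 t) (hle t)) (by positivity)
  have hupper : ∀ ε > 0, ∀ᶠ t : ℕ in atTop, Real.log (Vs t) / t ≤ W0 + ε := by
    intro ε hε
    filter_upwards [hup ε hε, eventually_gt_atTop 0] with t ht ht0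
    have ht' : (0 : ℝ) < t := by exact_mod_cast ht0
    rw [div_le_iff₀ ht', Real.log_le_iff_le_exp (hVs0 t)]
    refine ciSup_le fun π => ?_
    rw [← Real.log_le_iff_le_exp (hVb _ t).1, ← div_le_iff₀ ht']
    exact ht π
  have hlower : ∀ ε > 0, ∀ᶠ t : ℕ in atTop, W0 - ε ≤ Real.log (Vh t) / t := by
    intro ε hε
    obtain ⟨k, hk⟩ := exists_lt_of_lt_ciSup (show W0 - ε < ⨆ k, W (D k) by linarith)
    have h1 := (log_div_tendsto_zero (Real.log (m {k}).toReal)).add (hW (D k))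
    rw [zero_add] at h1
    filter_upwards [h1.eventually_const_lt hk] with t ht
    refine ht.le.trans ?_
    rw [← add_div, ← Real.log_mul (hmk k).ne' (hVb _ t).1.ne']
    exact div_le_div_of_nonneg_right
      (Real.log_le_log (mul_pos (hmk k) (hVb _ t).1) (hlow k t)) (by positivity)
  have T1 : Tendsto (fun t : ℕ => Real.log (Vh t) / t) atTop (𝓝 W0) := by
    rw [Metric.tendsto_nhds]
    intro ε hε
    filter_upwards [hupper (ε / 2) (half_pos hε), hlower (ε / 2) (half_pos hε)] with t h1 h2
    rw [Real.dist_eq, abs_lt]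
    have := hlogle t
    constructor <;> linarith
  have T2 : Tendsto (fun t : ℕ => Real.log (Vs t) / t) atTop (𝓝 W0) := by
    rw [Metric.tendsto_nhds]
    intro ε hε
    filter_upwards [hupper (ε / 2) (half_pos hε), hlower (ε / 2) (half_pos hε)] with t h1 h2
    rw [Real.dist_eq, abs_lt]
    have := hlogle t
    constructor <;> linarith
  refine ⟨rfl, T1, T2, ?_⟩
  have T3 := T1.sub T2
  rw [sub_self] at T3
  refine T3.congr fun t => ?_
  rw [← sub_div, ← Real.log_div (hVh0 t).ne' (hVs0 t).ne']
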